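/- arXiv:2403.03749 — 2 statements merged into one kernel-verified Lean document; each statement's English description precedes it below -/
import Mathlib

section
/- Let κ ∈ ℂ, let μ > 0 be real, and let z > 0 be real. Then the series z^{−μ−1/2} Σ_{ℓ=0}^∞ (−1)^ℓ · ((μ−κ+1/2)_ℓ / ((ℓ+2μ)_ℓ · ℓ!)) · M_{κ,ℓ+μ}(z) converges, and its sum equals e^{-z/2}. -/
open scoped BigOperators

noncomputable section

/-- Ascending Pochhammer symbol `(a)_n = a (a+1) ⋯ (a+n-1)`. -/
def aP (n : ℕ) (a : ℂ) : ℂ := (ascPochhammer ℂ n).eval a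

/-- The Whittaker function `M_{κ,μ}(z)` for `z > 0`:
`M_{κ,μ}(z) = e^{-z/2} z^{μ+1/2} ∑_n ((μ-κ+1/2)_n / ((2μ+1)_n n!)) z^n`,
with the principal power `z^{μ+1/2}`. -/
def whittakerM (κ μ : ℂ) (z : ℝ) : ℂ :=
  Complex.exp (-(z : ℂ) / 2) * (z : ℂ) ^ (μ + 1 / 2) *
    ∑' n : ℕ, aP n (μ - κ + 1 / 2) / (aP n (2 * μ + 1) * (n.factorial : ℂ)) * (z : ℂ) ^ n

lemma aP_eq_prod (n : ℕ) (a : ℂ) : aP n a = ∏ k ∈ Finset.range n, (a + k) := by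
  induction n with
  | zero => simp [aP]
  | succ n ih =>
    rw [Finset.prod_range_succ, ← ih]
    simp [aP, ascPochhammer_succ_eval]

lemma aP_add (m n : ℕ) (a : ℂ) : aP (m + n) a = aP m a * aP n (a + m) := by
  simp only [aP_eq_prod, Finset.prod_range_add]
  congr 1
  refine Finset.prod_congr rfl fun k _ => ?_
  push_cast
  ring

lemma aP_one (a : ℂ) : aP 1 a = a := by simp [aP]

lemma norm_aP_le (n : ℕ) (a : ℂ) : ‖aP n a‖ ≤ (‖a‖ + 1) ^ n * n.factorial := by
  rw [aP_eq_prod, norm_prod, ← Finset.prod_range_add_one_eq_factorial, Nat.cast_prod,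
    ← Finset.card_range n, ← Finset.prod_const, Finset.card_range, ← Finset.prod_mul_distrib]
  refine Finset.prod_le_prod (fun _ _ => norm_nonneg _) fun k _ => ?_
  have h := norm_add_le a (k : ℂ)
  rw [Complex.norm_natCast] at h
  push_cast
  nlinarith [norm_nonneg a, mul_nonneg (norm_nonneg a) (Nat.cast_nonneg (α := ℝ) k)]

lemma factorial_le_norm_aP (n : ℕ) (a : ℂ) (h : n ≠ 0 → 1 ≤ a.re) :
    (n.factorial : ℝ) ≤ ‖aP n a‖ := by
  rw [aP_eq_prod, norm_prod, ← Finset.prod_range_add_one_eq_factorial, Nat.cast_prod]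
  refine Finset.prod_le_prod (fun _ _ => Nat.cast_nonneg _) fun k hk => ?_
  have h1 := h (Nat.ne_zero_of_lt (Finset.mem_range.mp hk))
  have h2 := Complex.re_le_norm (a + k)
  simp only [Complex.add_re, Complex.natCast_re] at h2
  push_cast
  linarith

lemma aP_ne_zero (n : ℕ) {a : ℂ} (h : 0 < a.re) : aP n a ≠ 0 := by
  rw [aP_eq_prod, Finset.prod_ne_zero_iff]
  intro k _ h0
  have := congrArg Complex.re h0
  simp only [Complex.add_re, Complex.natCast_re, Complex.zero_re] at this
  have : (0 : ℝ) ≤ k := Nat.cast_nonneg k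
  linarith

lemma sum_range_alternating_choose_div_aP {b : ℂ} (hb : 0 < b.re) (M L : ℕ) :
    ∑ l ∈ Finset.range (L + 1),
        (-1) ^ l * ((M + 1).choose l : ℂ) * (b + 2 * l) / aP (M + 2) (b + l) =
      (-1) ^ L * (M.choose L : ℂ) / aP (M + 1) (b + L + 1) := by
  induction L with
  | zero =>
    have h0 : b ≠ 0 := by rintro rfl; simp at hb
    have h1 : aP (M + 2) b = b * aP (M + 1) (b + 1) := by
      rw [show M + 2 = 1 + (M + 1) by ring, aP_add, aP_one, Nat.cast_one]
    have h2 : aP (M + 1) (b + 1) ≠ 0 := aP_ne_zero _ (by simp; linarith)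
    simp [h1]
    field_simp
  | succ L ih =>
    rw [Finset.sum_range_succ, ih]
    have hL : (0 : ℝ) ≤ L := Nat.cast_nonneg L
    have hP : aP (M + 2) (b + L + 1) ≠ 0 := aP_ne_zero _ (by simp; linarith)
    have h1 : aP (M + 2) (b + L + 1) = (b + L + 1) * aP (M + 1) (b + L + 1 + 1) := by
      rw [show M + 2 = 1 + (M + 1) by ring, aP_add, aP_one, Nat.cast_one]
    have h2 : aP (M + 2) (b + L + 1) = aP (M + 1) (b + L + 1) * (b + L + 1 + (M + 1)) := by
      rw [show M + 2 = M + 1 + 1 by ring, aP_add, aP_one, Nat.cast_add, Nat.cast_one]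
    have hA : aP (M + 1) (b + L + 1) ≠ 0 := left_ne_zero_of_mul (h2 ▸ hP)
    have hB : aP (M + 1) (b + L + 1 + 1) ≠ 0 := right_ne_zero_of_mul (h1 ▸ hP)
    have eA (x : ℂ) : x / aP (M + 1) (b + L + 1) =
        x * (b + L + 1 + (M + 1)) / aP (M + 2) (b + L + 1) := by
      rw [div_eq_div_iff hA hP, h2]; ring
    have eB (x : ℂ) : x / aP (M + 1) (b + L + 1 + 1) =
        x * (b + L + 1) / aP (M + 2) (b + L + 1) := by
      rw [div_eq_div_iff hB hP, h1]; ring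
    have hc : ((M : ℂ) + 1) * M.choose L = (M.choose L + M.choose (L + 1)) * (L + 1) := by
      exact_mod_cast Nat.add_one_mul_choose_eq M L
    rw [Nat.choose_succ_succ, Nat.cast_add, Nat.cast_add, Nat.cast_one, ← add_assoc, eA, eB,
      ← add_div]
    congr 1
    rw [pow_succ]
    linear_combination (-1) ^ L * hc

/-- The term of index `(ℓ, n)` of the double series obtained by expanding each Whittaker function,
with `a = μ - κ + 1/2` and `b = 2μ`. -/
def whittakerDoubleTerm (a b z : ℂ) (p : ℕ × ℕ) : ℂ :=
  (-1) ^ p.1 * (aP p.1 a / (aP p.1 (p.1 + b) * (p.1.factorial : ℂ))) *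
    (aP p.2 (a + p.1) / (aP p.2 (b + 2 * p.1 + 1) * (p.2.factorial : ℂ))) * z ^ (p.1 + p.2)

lemma whittakerDoubleTerm_eq (a : ℂ) {b : ℂ} (hb : 0 < b.re) (z : ℂ) (l n : ℕ) :
    whittakerDoubleTerm a b z (l, n) = aP (l + n) a * z ^ (l + n) / ((l + n).factorial : ℂ) *
      ((-1) ^ l * ((l + n).choose l : ℂ) * (b + 2 * l) / aP (l + n + 1) (b + l)) := by
  have hl : (0 : ℝ) ≤ l := Nat.cast_nonneg l
  have h1 : aP (l + n + 1) (b + l) =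
      aP l (l + b) * ((b + 2 * l) * aP n (b + 2 * l + 1)) := by
    rw [show l + n + 1 = l + (1 + n) by ring, aP_add, aP_add, aP_one, Nat.cast_one,
      add_comm b (l : ℂ), show (l : ℂ) + b + l = b + 2 * l by ring]
  have h2 : aP l (l + b) ≠ 0 := aP_ne_zero _ (by simp; linarith)
  have h3 : aP n (b + 2 * l + 1) ≠ 0 := aP_ne_zero _ (by simp; linarith)
  have h4 : b + 2 * l ≠ 0 := by
    intro h
    have := congrArg Complex.re h
    simp at this
    linarith
  have f1 : (l.factorial : ℂ) ≠ 0 := Nat.cast_ne_zero.mpr l.factorial_ne_zero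
  have f2 : (n.factorial : ℂ) ≠ 0 := Nat.cast_ne_zero.mpr n.factorial_ne_zero
  have f3 : ((l + n).factorial : ℂ) ≠ 0 := Nat.cast_ne_zero.mpr (l + n).factorial_ne_zero
  have hc : ((l + n).choose l : ℂ) * l.factorial * n.factorial = (l + n).factorial := by
    rw [Nat.choose_symm_add]
    exact_mod_cast Nat.add_choose_mul_factorial_mul_factorial l n
  rw [whittakerDoubleTerm, h1, aP_add l n a, ← hc]
  have f4 : ((l + n).choose l : ℂ) ≠ 0 := by
    intro h; rw [h] at hc; simp at hc; exact f3 hc.symm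
  generalize b + 2 * (l : ℂ) = c at h3 h4 ⊢
  field_simp

lemma sum_antidiagonal_whittakerDoubleTerm (a : ℂ) {b : ℂ} (hb : 0 < b.re) (z : ℂ) (N : ℕ) :
    ∑ p ∈ Finset.HasAntidiagonal.antidiagonal N, whittakerDoubleTerm a b z p = if N = 0 then 1 else 0 := by
  cases N with
  | zero => simp [whittakerDoubleTerm, aP]
  | succ M =>
    have h : ∀ p ∈ Finset.HasAntidiagonal.antidiagonal (M + 1), whittakerDoubleTerm a b z p =
        aP (M + 1) a * z ^ (M + 1) / ((M + 1).factorial : ℂ) *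
          ((-1) ^ p.1 * ((M + 1).choose p.1 : ℂ) * (b + 2 * p.1) / aP (M + 2) (b + p.1)) := by
      rintro ⟨l, n⟩ hp
      rw [whittakerDoubleTerm_eq a hb, Finset.HasAntidiagonal.mem_antidiagonal.mp hp]
    rw [Finset.sum_congr rfl h, ← Finset.mul_sum, Finset.Nat.sum_antidiagonal_eq_sum_range_succ_mk,
      sum_range_alternating_choose_div_aP hb]
    simp

lemma summable_whittakerDoubleTerm (a : ℂ) {b : ℂ} (hb : 0 < b.re) (z : ℂ) :
    Summable (whittakerDoubleTerm a b z) := by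
  set r : ℝ := 2 * (‖a‖ + 1) * ‖z‖ with hr
  have hs := Real.summable_pow_div_factorial r
  have hn (n : ℕ) : 0 ≤ r ^ n / (n.factorial : ℝ) := by positivity
  refine Summable.of_norm_bounded (hs.mul_of_nonneg hs hn hn) ?_
  rintro ⟨l, n⟩
  have hl : (0 : ℝ) ≤ l := Nat.cast_nonneg l
  have h1 : (l.factorial : ℝ) ≤ ‖aP l (l + b)‖ := by
    refine factorial_le_norm_aP _ _ fun h => ?_
    have : (1 : ℝ) ≤ l := Nat.one_le_cast.mpr (Nat.one_le_iff_ne_zero.mpr h)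
    simp
    linarith
  have h2 : (n.factorial : ℝ) ≤ ‖aP n (b + 2 * l + 1)‖ :=
    factorial_le_norm_aP _ _ fun _ => by simp; linarith
  have f1 : (0 : ℝ) < l.factorial := Nat.cast_pos.mpr l.factorial_pos
  have f2 : (0 : ℝ) < n.factorial := Nat.cast_pos.mpr n.factorial_pos
  have hc : ((l + n).choose l : ℝ) * l.factorial * n.factorial = (l + n).factorial := by
    rw [Nat.choose_symm_add]
    exact_mod_cast Nat.add_choose_mul_factorial_mul_factorial l n
  have hc2 : ((l + n).choose l : ℝ) ≤ 2 ^ (l + n) := by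
    exact_mod_cast Nat.choose_le_two_pow (l + n) l
  have ha : ‖aP (l + n) a‖ ≤ (‖a‖ + 1) ^ (l + n) * (2 ^ (l + n) * l.factorial * n.factorial) := by
    refine (norm_aP_le _ _).trans ?_
    rw [← hc]
    gcongr
  have e : ‖whittakerDoubleTerm a b z (l, n)‖ = ‖aP (l + n) a‖ * ‖z‖ ^ (l + n) /
      ((‖aP l (l + b)‖ * l.factorial) * (‖aP n (b + 2 * l + 1)‖ * n.factorial)) := by
    simp only [whittakerDoubleTerm, aP_add, norm_mul, norm_div, norm_pow, norm_neg, norm_one,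
      one_pow, Complex.norm_natCast]
    ring
  rw [e]
  calc _ ≤ (‖a‖ + 1) ^ (l + n) * (2 ^ (l + n) * l.factorial * n.factorial) * ‖z‖ ^ (l + n) /
      (((l.factorial : ℝ) * l.factorial) * (n.factorial * n.factorial)) := by gcongr
    _ = _ := by
      simp only [hr, mul_pow, pow_add]
      field_simp

lemma hasSum_whittakerDoubleTerm (a : ℂ) {b : ℂ} (hb : 0 < b.re) (z : ℂ) :
    HasSum (whittakerDoubleTerm a b z) 1 := by
  have hs := (summable_whittakerDoubleTerm a hb z).hasSum
  have h := (Finset.HasAntidiagonal.sigmaAntidiagonalEquivProd.hasSum_iff.mpr hs).sigma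
    fun N => hasSum_fintype _
  have h1 : HasSum (fun N : ℕ => if N = 0 then (1 : ℂ) else 0) 1 := hasSum_ite_eq 0 1
  convert hs
  refine h1.unique ?_
  convert h using 2 with N
  rw [← sum_antidiagonal_whittakerDoubleTerm a hb z N, ← Finset.sum_coe_sort]
  rfl

/-- The `c = -1` (i.e. `γ = π`) specialization of the summation formula for the Whittaker
functions `M_{κ,μ}`. -/
theorem whittakerM_summation_gamma_pi (κ : ℂ) (μ : ℝ) (hμ : 0 < μ) (z : ℝ) (hz : 0 < z) :
    HasSum
      (fun ℓ : ℕ =>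
        (z : ℂ) ^ (-(μ : ℂ) - 1 / 2) * ((-1) ^ ℓ *
          (aP ℓ ((μ : ℂ) - κ + 1 / 2) / (aP ℓ ((ℓ : ℂ) + 2 * μ) * (ℓ.factorial : ℂ))) *
          whittakerM κ ((ℓ : ℂ) + μ) z))
      (Complex.exp (-(z : ℂ) / 2)) := by
  have hb : 0 < (2 * (μ : ℂ)).re := by simpa using hμ
  have hz0 : (z : ℂ) ≠ 0 := Complex.ofReal_ne_zero.mpr hz.ne'
  set a : ℂ := (μ : ℂ) - κ + 1 / 2 with ha
  have hs := hasSum_whittakerDoubleTerm a hb z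
  have h := (hs.prod_fiberwise fun l => (hs.summable.prod_factor l).hasSum).mul_left
    (Complex.exp (-(z : ℂ) / 2))
  rw [mul_one] at h
  refine h.congr_fun fun l => ?_
  have hp : (z : ℂ) ^ (-(μ : ℂ) - 1 / 2) * (z : ℂ) ^ ((l : ℂ) + μ + 1 / 2) = (z : ℂ) ^ l := by
    rw [← Complex.cpow_add _ _ hz0, ← Complex.cpow_natCast]
    congr 1
    ring
  simp only [whittakerDoubleTerm, whittakerM, pow_add, ← hp]
  rw [← tsum_mul_left, ← tsum_mul_left, ← tsum_mul_left, ← tsum_mul_left]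
  refine tsum_congr fun n => ?_
  rw [show (l : ℂ) + μ - κ + 1 / 2 = a + l by rw [ha]; ring,
    show 2 * ((l : ℂ) + μ) + 1 = 2 * (μ : ℂ) + 2 * l + 1 by ring]
  ring
end
end

section
/- Let κ ∈ ℂ, let μ > 0 be real, and let z > 0 be real. Then the series Σ_{ℓ=0}^∞ ((μ−κ+1/2)_ℓ / ((ℓ+2μ)_ℓ · ℓ!)) · M_{κ,ℓ+μ}(z) converges, and its sum equals e^{-z/2} · z^{μ+1/2} · ₁F₁(μ−κ+1/2; μ+1/2; z). -/
open scoped BigOperators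

noncomputable section

/-- The confluent hypergeometric function `₁F₁(a; b; z) = ∑_n ((a)_n / ((b)_n n!)) z^n`. -/
def hyp1F1 (a b z : ℂ) : ℂ :=
  ∑' n : ℕ, aP n a / (aP n b * (n.factorial : ℂ)) * z ^ n

/-- The Pochhammer polynomial satisfies `(x)_{n+1} = x (x+1)_n`. -/
theorem ascPochhammer_succ_left_eval {S : Type*} [CommRing S] (n : ℕ) (x : S) :
    (ascPochhammer S (n + 1)).eval x = x * (ascPochhammer S n).eval (x + 1) := by
  simp [ascPochhammer_succ_left]

/-- The Pochhammer polynomial satisfies `(x)_{m+n} = (x)_m (x+m)_n`. -/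
theorem ascPochhammer_add_eval {S : Type*} [CommRing S] (m n : ℕ) (x : S) :
    (ascPochhammer S (m + n)).eval x =
      (ascPochhammer S m).eval x * (ascPochhammer S n).eval (x + m) := by
  simp [← ascPochhammer_mul]

theorem aP_ofReal (n : ℕ) (x : ℝ) : aP n (x : ℂ) = ((ascPochhammer ℝ n).eval x : ℝ) := by
  induction n with
  | zero => simp [aP]
  | succ n ih =>
    unfold aP at ih ⊢
    rw [ascPochhammer_succ_eval, ascPochhammer_succ_eval, ih]
    push_cast
    ring

/-- Telescoped (Zeilberger) form of the recurrence in `N` for the sum of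
`sum_choose_mul_div_ascPochhammer`. -/
theorem sum_range_zeilberger {b : ℝ} (hb : 0 < b) (N k : ℕ) :
    ∑ l ∈ Finset.range (k + 1),
      ((b + 1 + 2 * N) * ((N + 1).choose l * (b + 2 * l) / (ascPochhammer ℝ (N + 2)).eval (b + l))
        - 2 * (N.choose l * (b + 2 * l) / (ascPochhammer ℝ (N + 1)).eval (b + l))) =
      -(N.choose k * (b + 2 * k + 1) / (ascPochhammer ℝ (N + 1)).eval (b + k + 1)) := by
  induction k with
  | zero =>
    have hp := ascPochhammer_pos (S := ℝ) N (b + 1) (by positivity)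
    have h1 : (ascPochhammer ℝ (N + 2)).eval b =
        b * ((ascPochhammer ℝ N).eval (b + 1) * (b + 1 + N)) := by
      rw [ascPochhammer_succ_left_eval, ascPochhammer_succ_eval]
    have h2 : (ascPochhammer ℝ (N + 1)).eval b = b * (ascPochhammer ℝ N).eval (b + 1) :=
      ascPochhammer_succ_left_eval _ _
    have h3 := ascPochhammer_succ_eval N (b + 1)
    simp only [zero_add, Finset.sum_range_one, Nat.choose_zero_right, Nat.cast_zero, Nat.cast_one,
      mul_zero, add_zero, h1, h2, h3]
    field_simp
    ring
  | succ k ih =>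
    rw [Finset.sum_range_succ, ih]
    set x : ℝ := b + k + 1 with hx
    have hx0 : 0 < x := by positivity
    have hp := ascPochhammer_pos (S := ℝ) N (x + 1) (by positivity)
    have e1 : b + ((k + 1 : ℕ) : ℝ) = x := by rw [hx]; push_cast; ring
    have h1 : (ascPochhammer ℝ (N + 2)).eval x =
        x * ((ascPochhammer ℝ N).eval (x + 1) * (x + 1 + N)) := by
      rw [ascPochhammer_succ_left_eval, ascPochhammer_succ_eval]
    have h2 : (ascPochhammer ℝ (N + 1)).eval x = x * (ascPochhammer ℝ N).eval (x + 1) :=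
      ascPochhammer_succ_left_eval _ _
    have h3 := ascPochhammer_succ_eval N (x + 1)
    have hc : (N.choose (k + 1) : ℝ) * (k + 1) = N.choose k * (N - k) := by
      rcases le_or_gt k N with h | h
      · have := Nat.choose_succ_right_eq N k
        rw [← Nat.cast_sub h]
        exact_mod_cast this
      · simp [Nat.choose_eq_zero_of_lt h, Nat.choose_eq_zero_of_lt (h.trans (Nat.lt_succ_self k))]
    have hb' : b = x - k - 1 := by rw [hx]; ring
    rw [e1, h1, h2, h3, Nat.choose_succ_succ']
    push_cast
    rw [hb']
    field_simp
    linear_combination (-(x + k + 2)) * hc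

/-- A very-well-poised terminating sum. -/
theorem sum_choose_mul_div_ascPochhammer {b : ℝ} (hb : 0 < b) (N : ℕ) :
    ∑ l ∈ Finset.range (N + 1),
      N.choose l * (b + 2 * l) / (ascPochhammer ℝ (N + 1)).eval (b + l) =
      1 / (ascPochhammer ℝ N).eval ((b + 1) / 2) := by
  induction N with
  | zero => simp [hb.ne']
  | succ N ih =>
    have h := sum_range_zeilberger hb N (N + 1)
    rw [Finset.sum_sub_distrib, ← Finset.mul_sum, ← Finset.mul_sum,
      Finset.sum_range_succ (fun l : ℕ =>
        N.choose l * (b + 2 * l) / (ascPochhammer ℝ (N + 1)).eval (b + l)), ih] at h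
    simp only [Nat.choose_succ_self, Nat.cast_zero, zero_mul, zero_div, neg_zero, add_zero] at h
    have hp := ascPochhammer_pos (S := ℝ) N ((b + 1) / 2) (by positivity)
    have hN : 0 < b + 1 + 2 * N := by positivity
    rw [ascPochhammer_succ_eval]
    rw [sub_eq_zero] at h
    have h' : ∀ s : ℝ, (b + 1 + 2 * N) * s = 2 * (1 / (ascPochhammer ℝ N).eval ((b + 1) / 2)) →
        s = 1 / ((ascPochhammer ℝ N).eval ((b + 1) / 2) * ((b + 1) / 2 + N)) := by
      intro s hs
      have h2 : (b + 1) / 2 + (N : ℝ) = (b + 1 + 2 * N) / 2 := by ring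
      rw [h2]
      field_simp at hs ⊢
      linear_combination hs
    exact h' _ h

theorem sum_antidiagonal_inv_ascPochhammer {b : ℝ} (hb : 0 < b) (N : ℕ) :
    ∑ p ∈ Finset.HasAntidiagonal.antidiagonal N,
      1 / ((ascPochhammer ℝ p.1).eval (p.1 + b) * p.1.factorial *
        ((ascPochhammer ℝ p.2).eval (b + 2 * p.1 + 1) * p.2.factorial)) =
      1 / ((ascPochhammer ℝ N).eval ((b + 1) / 2) * N.factorial) := by
  rw [← div_div, ← sum_choose_mul_div_ascPochhammer hb, Finset.sum_div,
    ← Finset.Nat.sum_antidiagonal_eq_sum_range_succ_mk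
      (f := fun p : ℕ × ℕ => (N.choose p.1 : ℝ) * (b + 2 * p.1) /
        (ascPochhammer ℝ (N + 1)).eval (b + p.1) / N.factorial)]
  refine Finset.sum_congr rfl fun p hp => ?_
  obtain ⟨l, n⟩ := p
  obtain rfl : l + n = N := by simpa using hp
  have h1 := ascPochhammer_pos (S := ℝ) l (b + l) (by positivity)
  have h2 := ascPochhammer_pos (S := ℝ) n (b + 2 * l + 1) (by positivity)
  have h3 : (ascPochhammer ℝ (l + n + 1)).eval (b + l) = (ascPochhammer ℝ l).eval (b + l) *
      ((b + 2 * l) * (ascPochhammer ℝ n).eval (b + 2 * l + 1)) := by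
    rw [add_assoc, ascPochhammer_add_eval, ascPochhammer_succ_left_eval,
      show b + l + (l : ℝ) = b + 2 * l by ring]
  have h4 : ((l + n).choose l : ℝ) * (l.factorial * n.factorial) = (l + n).factorial := by
    have := Nat.add_choose_mul_factorial_mul_factorial l n
    rw [← Nat.choose_symm_add] at this
    rw [← mul_assoc]
    exact_mod_cast this
  simp only [h3, add_comm (l : ℝ) b]
  have h5 : 0 < b + 2 * l := by positivity
  generalize (ascPochhammer ℝ n).eval (b + 2 * l + 1) = y at h2 ⊢
  field_simp
  linear_combination -h4

/-- The power series of `₁F₁(a; c; z)` converges absolutely for `c > 0`. -/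
theorem summable_norm_hyp1F1_term (a : ℂ) {c : ℝ} (hc : 0 < c) (z : ℂ) :
    Summable fun n : ℕ => ‖aP n a / (aP n (c : ℂ) * (n.factorial : ℂ)) * z ^ n‖ := by
  refine summable_of_ratio_norm_eventually_le (r := 1 / 2) (by norm_num) ?_
  filter_upwards [Filter.eventually_ge_atTop ⌈2 * (‖a‖ + 1) * ‖z‖⌉₊] with n hn
  have hn' : 2 * (‖a‖ + 1) * ‖z‖ ≤ n := Nat.ceil_le.mp hn
  have hp := ascPochhammer_pos (S := ℝ) n c hc
  have e1 : aP (n + 1) a = aP n a * (a + n) := ascPochhammer_succ_eval n a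
  have e2 : aP (n + 1) (c : ℂ) = aP n (c : ℂ) * ((c + n : ℝ) : ℂ) := by
    push_cast
    exact ascPochhammer_succ_eval n (c : ℂ)
  have e3 : aP (n + 1) a / (aP (n + 1) (c : ℂ) * ((n + 1).factorial : ℂ)) * z ^ (n + 1) =
      ((a + n) * z / (((c + n : ℝ) : ℂ) * ((n + 1 : ℝ) : ℂ))) *
        (aP n a / (aP n (c : ℂ) * (n.factorial : ℂ)) * z ^ n) := by
    rw [e1, e2, Nat.factorial_succ, pow_succ]
    push_cast
    simp only [div_eq_mul_inv, mul_inv]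
    ring
  rw [norm_norm, norm_norm, e3, norm_mul]
  refine mul_le_mul_of_nonneg_right ?_ (norm_nonneg _)
  have hcn : 0 < c + n := by positivity
  have hn1 : (0 : ℝ) < n + 1 := by positivity
  rw [norm_div, norm_mul, norm_mul, Complex.norm_real, Complex.norm_real,
    Real.norm_of_nonneg hcn.le, Real.norm_of_nonneg hn1.le, div_le_iff₀ (by positivity)]
  have ha : ‖a + n‖ ≤ (‖a‖ + 1) * (n + 1) := by
    have := norm_add_le a (n : ℂ)
    rw [Complex.norm_natCast] at this
    nlinarith [norm_nonneg a, (Nat.cast_nonneg n : (0 : ℝ) ≤ n),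
      mul_nonneg (norm_nonneg a) (Nat.cast_nonneg n : (0 : ℝ) ≤ n)]
  calc ‖a + n‖ * ‖z‖ ≤ ((‖a‖ + 1) * (n + 1)) * ‖z‖ :=
        mul_le_mul_of_nonneg_right ha (norm_nonneg _)
    _ ≤ 1 / 2 * ((c + n) * (n + 1)) := by nlinarith

/-- Expansion of `₁F₁(a; (b+1)/2; z)` as a double series. -/
theorem hasSum_double_hyp1F1 (a : ℂ) {b : ℝ} (hb : 0 < b) (z : ℂ) :
    HasSum (fun p : ℕ × ℕ =>
      aP (p.1 + p.2) a * z ^ (p.1 + p.2) *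
        ((1 / ((ascPochhammer ℝ p.1).eval (p.1 + b) * p.1.factorial *
          ((ascPochhammer ℝ p.2).eval (b + 2 * p.1 + 1) * p.2.factorial)) : ℝ) : ℂ))
      (hyp1F1 a (((b + 1) / 2 : ℝ) : ℂ) z) := by
  set r : ℕ × ℕ → ℝ := fun p => 1 / ((ascPochhammer ℝ p.1).eval (p.1 + b) * p.1.factorial *
          ((ascPochhammer ℝ p.2).eval (b + 2 * p.1 + 1) * p.2.factorial)) with hr
  have hr0 : ∀ p, 0 ≤ r p := fun p => by
    have h1 := ascPochhammer_pos (S := ℝ) p.1 (p.1 + b) (by positivity)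
    have h2 := ascPochhammer_pos (S := ℝ) p.2 (b + 2 * p.1 + 1) (by positivity)
    simp only [hr]
    positivity
  have hterm : ∀ N : ℕ, aP N a / (aP N (((b + 1) / 2 : ℝ) : ℂ) * (N.factorial : ℂ)) * z ^ N =
      aP N a * z ^ N * ((∑ p ∈ Finset.HasAntidiagonal.antidiagonal N, r p : ℝ) : ℂ) := fun N => by
    rw [sum_antidiagonal_inv_ascPochhammer hb N, aP_ofReal]
    push_cast
    ring
  have hsum := summable_norm_hyp1F1_term a (c := (b + 1) / 2) (by positivity) z
  rw [← Finset.HasAntidiagonal.sigmaAntidiagonalEquivProd.hasSum_iff]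
  set f : (Σ n : ℕ, Finset.HasAntidiagonal.antidiagonal n) → ℂ :=
    (fun p : ℕ × ℕ => aP (p.1 + p.2) a * z ^ (p.1 + p.2) * (r p : ℂ)) ∘
      Finset.HasAntidiagonal.sigmaAntidiagonalEquivProd with hf
  have hfe : ∀ (N : ℕ) (p : Finset.HasAntidiagonal.antidiagonal N),
      f ⟨N, p⟩ = aP N a * z ^ N * (r p.1 : ℂ) := fun N p => by
    have : p.1.1 + p.1.2 = N := Finset.HasAntidiagonal.mem_antidiagonal.mp p.2
    simp [hf, this]
  have hsm : Summable f := by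
    refine Summable.of_norm ?_
    rw [summable_sigma_of_nonneg fun _ => norm_nonneg _]
    refine ⟨fun N => Summable.of_finite, hsum.congr fun N => ?_⟩
    rw [hterm, norm_mul, Complex.norm_real,
      Real.norm_of_nonneg (Finset.sum_nonneg fun p _ => hr0 p), tsum_fintype, Finset.mul_sum,
      ← Finset.sum_coe_sort]
    refine Finset.sum_congr rfl fun p _ => ?_
    simp only [hfe, norm_mul, Complex.norm_real, Real.norm_of_nonneg (hr0 _)]
  have hval : ∑' x, f x = hyp1F1 a (((b + 1) / 2 : ℝ) : ℂ) z := by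
    rw [hsm.tsum_sigma' fun N => Summable.of_finite, hyp1F1]
    refine tsum_congr fun N => ?_
    rw [hterm, tsum_fintype, Complex.ofReal_sum, Finset.mul_sum]
    exact (Finset.sum_congr rfl fun p _ => hfe N p).trans
      (Finset.sum_coe_sort (Finset.HasAntidiagonal.antidiagonal N)
        fun p => aP N a * z ^ N * (r p : ℂ))
  exact hval ▸ hsm.hasSum

/-- The `c = 1` (i.e. `γ = 0`) specialization of the summation formula for the Whittaker
functions `M_{κ,μ}`. -/
theorem whittakerM_summation_gamma_zero (κ : ℂ) (μ : ℝ) (hμ : 0 < μ) (z : ℝ) (hz : 0 < z) :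
    HasSum
      (fun ℓ : ℕ =>
        aP ℓ ((μ : ℂ) - κ + 1 / 2) / (aP ℓ ((ℓ : ℂ) + 2 * μ) * (ℓ.factorial : ℂ)) *
          whittakerM κ ((ℓ : ℂ) + μ) z)
      (Complex.exp (-(z : ℂ) / 2) * (z : ℂ) ^ ((μ : ℂ) + 1 / 2) *
        hyp1F1 ((μ : ℂ) - κ + 1 / 2) ((μ : ℂ) + 1 / 2) (z : ℂ)) := by
  have hb : 0 < 2 * μ := by positivity
  set a : ℂ := (μ : ℂ) - κ + 1 / 2 with ha
  have hz' : (z : ℂ) ≠ 0 := by exact_mod_cast hz.ne'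
  have hD := hasSum_double_hyp1F1 a hb (z : ℂ)
  rw [show (((2 * μ + 1) / 2 : ℝ) : ℂ) = (μ : ℂ) + 1 / 2 by push_cast; ring] at hD
  have h := (hD.prod_fiberwise fun l => (hD.summable.prod_factor l).hasSum).mul_left
    (Complex.exp (-(z : ℂ) / 2) * (z : ℂ) ^ ((μ : ℂ) + 1 / 2))
  refine h.congr_fun fun l => ?_
  have hpow : (z : ℂ) ^ ((l : ℂ) + μ + 1 / 2) = (z : ℂ) ^ l * (z : ℂ) ^ ((μ : ℂ) + 1 / 2) := by
    rw [add_assoc, Complex.cpow_add _ _ hz', Complex.cpow_natCast]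
  rw [whittakerM, hpow, ← tsum_mul_left, ← tsum_mul_left, ← tsum_mul_left]
  refine tsum_congr fun n => ?_
  have e1 : (l : ℂ) + 2 * μ = ((l + 2 * μ : ℝ) : ℂ) := by push_cast; ring
  have e2 : 2 * ((l : ℂ) + μ) + 1 = ((2 * μ + 2 * l + 1 : ℝ) : ℂ) := by push_cast; ring
  have e3 : aP (l + n) a = aP l a * aP n ((l : ℂ) + μ - κ + 1 / 2) := by
    rw [show (l : ℂ) + μ - κ + 1 / 2 = a + l by rw [ha]; ring]
    exact ascPochhammer_add_eval l n a
  rw [e1, e2, e3, aP_ofReal, aP_ofReal, pow_add]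
  push_cast
  simp only [div_eq_mul_inv, mul_inv]
  ring
end
end
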